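/- arXiv:1202.5813 — 3 statements merged into one kernel-verified Lean document; each statement's English description precedes it below -/
import Mathlib

section
/- Suppose f : ℝⁿ → ℝⁿ is injective, continuous, and there exist r > 0 and c ∈ ℝⁿ such that f(x) = c + x whenever ‖x‖ ≥ r. Then f is a bijection of ℝⁿ onto ℝⁿ. -/
open MeasureTheory Metric Polynomial Function
open scoped NNReal

theorem exists_polynomial_eval_eq_setIntegral {Y : Type*} [TopologicalSpace Y] [MeasurableSpace Y]
    [OpensMeasurableSpace Y] [T2Space Y] (μ : Measure Y) [IsFiniteMeasureOnCompacts μ] {s : Set Y}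
    (hs : IsCompact s) (P : C(Y, ℝ)[X]) :
    ∃ Q : ℝ[X], ∀ t, Q.eval t =
      ∫ x in s, P.eval₂ ((Pi.evalRingHom _ x).comp ContinuousMap.coeFnRingHom) t ∂μ := by
  refine ⟨∑ i ∈ Finset.range (P.natDegree + 1), C (∫ x in s, P.coeff i x ∂μ) * X ^ i, fun t => ?_⟩
  simp only [eval₂_eq_sum_range, eval_finsetSum, eval_mul, eval_C, eval_pow, eval_X]
  rw [integral_finsetSum]
  · exact Finset.sum_congr rfl fun i _ => (integral_mul_const _ _).symm
  · exact fun i _ => ((P.coeff i).continuous.continuousOn.integrableOn_compact' hs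
      hs.measurableSet).mul_const _

theorem exists_polynomial_eval₂_eq_det {Y E : Type*} [TopologicalSpace Y] [NormedAddCommGroup E]
    [NormedSpace ℝ E] [FiniteDimensional ℝ E] {A : Y → E →L[ℝ] E} (hA : Continuous A) :
    ∃ P : C(Y, ℝ)[X], ∀ x t,
      P.eval₂ ((Pi.evalRingHom _ x).comp ContinuousMap.coeFnRingHom) t =
        (ContinuousLinearMap.id ℝ E + t • A x).det := by
  classical
  let b := Module.finBasis ℝ E
  have hcont (i j) : Continuous fun x => LinearMap.toMatrix b b (A x) i j := by
    simp only [LinearMap.toMatrix_apply]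
    exact (b.coord i).continuous_of_finiteDimensional.comp (hA.clm_apply continuous_const)
  refine ⟨(1 + (X : C(Y, ℝ)[X]) • (Matrix.of fun i j => (⟨_, hcont i j⟩ : C(Y, ℝ))).map C).det,
    fun x t => ?_⟩
  rw [← coe_eval₂RingHom, RingHom.map_det, ContinuousLinearMap.det, ← LinearMap.det_toMatrix b]
  congr 1
  ext i j
  by_cases hij : i = j <;> simp [hij, LinearMap.toMatrix_apply] <;> ring

theorem bijective_add_smul_of_lipschitzWith {E : Type*} [NormedAddCommGroup E] [NormedSpace ℝ E]
    [CompleteSpace E] {u : E → E} {K : ℝ≥0} (hu : LipschitzWith K u) {t : ℝ}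
    (ht : ‖t‖₊ * K < 1) : Bijective fun x => x + t • u x := by
  have hlip (y : E) : ContractingWith (‖t‖₊ * K) fun x => y - t • u x :=
    ⟨ht, by simpa using (LipschitzWith.const y).sub ((lipschitzWith_smul t).comp hu)⟩
  refine ⟨fun x x' h => ?_, fun y => ?_⟩
  · have hx : IsFixedPt (fun z => (x + t • u x) - t • u z) x := by simp [IsFixedPt]
    have hx' : IsFixedPt (fun z => (x + t • u x) - t • u z) x' := by
      simp only at h
      simp [IsFixedPt, h]
    exact (hlip _).fixedPoint_unique' hx hx'
  · have hfix := (hlip y).fixedPoint_isFixedPt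
    exact ⟨_, (sub_eq_iff_eq_add.mp hfix).symm⟩

theorem Function.Bijective.image_eq_of_eq_self_off {X : Type*} {h : X → X} (hh : Bijective h)
    {s : Set X} (hs : ∀ x ∉ s, h x = x) : h '' s = s := by
  have : h '' sᶜ = sᶜ := by
    exact (Set.image_congr hs).trans (Set.image_id _)
  rw [Set.image_compl_eq hh] at this
  exact compl_injective this

section ChangeOfVariables

variable {E : Type*} [NormedAddCommGroup E] [NormedSpace ℝ E] [FiniteDimensional ℝ E]
  [MeasurableSpace E] [BorelSpace E] (μ : Measure E) [μ.IsAddHaarMeasure]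

theorem exists_forall_setIntegral_det_mul_comp_eq {u : E → E} {s : Set E} (hs : IsCompact s)
    (hu : ContDiff ℝ 1 u) (hus : ∀ x ∉ s, u x = 0) :
    ∃ δ > (0 : ℝ), ∀ t ∈ Set.Ioo 0 δ, ∀ g : E → ℝ,
      ∫ x in s, (ContinuousLinearMap.id ℝ E + t • fderiv ℝ u x).det * g (x + t • u x) ∂μ =
        ∫ x in s, g x ∂μ := by
  obtain ⟨K, hK⟩ := hu.lipschitzWith_of_hasCompactSupport (HasCompactSupport.intro hs hus)
    one_ne_zero
  have hdet : ∀ᶠ A in nhds (0 : E →L[ℝ] E), 0 < (ContinuousLinearMap.id ℝ E + A).det := by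
    have hc : Continuous fun A : E →L[ℝ] E => (ContinuousLinearMap.id ℝ E + A).det :=
      ContinuousLinearMap.continuous_det.comp (continuous_const.add continuous_id)
    refine hc.continuousAt.eventually (lt_mem_nhds ?_)
    simp [ContinuousLinearMap.det]
  obtain ⟨η, hη, hpos⟩ := Metric.eventually_nhds_iff.mp hdet
  refine ⟨min 1 η / (K + 1), by positivity, fun t ht g => ?_⟩
  have htK : |t| * K < min 1 η := by
    rw [abs_of_pos ht.1]
    have := (lt_div_iff₀ (by positivity)).mp ht.2
    nlinarith [ht.1]
  have hbij : Bijective fun x => x + t • u x := by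
    refine bijective_add_smul_of_lipschitzWith hK ?_
    rw [← NNReal.coe_lt_coe]
    simpa using htK.trans_le (min_le_left _ _)
  have hderiv (x : E) : HasFDerivAt (fun x => x + t • u x)
      (ContinuousLinearMap.id ℝ E + t • fderiv ℝ u x) x :=
    (hasFDerivAt_id x).add ((hu.differentiable one_ne_zero x).hasFDerivAt.const_smul t)
  have himage := hbij.image_eq_of_eq_self_off (s := s) fun x hx => by simp [hus x hx]
  conv_rhs => rw [← himage]
  rw [integral_image_eq_integral_abs_det_fderiv_smul μ hs.measurableSet
    (fun x _ => (hderiv x).hasFDerivWithinAt) hbij.injective.injOn]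
  refine integral_congr_ae (.of_forall fun x => ?_)
  have hx : 0 < (ContinuousLinearMap.id ℝ E + t • fderiv ℝ u x).det := by
    refine hpos ?_
    rw [dist_zero_right, norm_smul, Real.norm_eq_abs]
    exact (mul_le_mul_of_nonneg_left (norm_fderiv_le_of_lipschitz ℝ hK) (abs_nonneg t)).trans_lt
      (htK.trans_le (min_le_right _ _))
  simp [abs_of_pos hx]

/-- If `g (x + t • u x)` is polynomial in `t` with continuous coefficients, the change of variables
formula for the map `x ↦ x + u x` holds without any injectivity assumption: both sides depend
polynomially on `t` and agree for small `t`. -/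
theorem setIntegral_det_mul_comp_eq {u : E → E} {s : Set E} (hs : IsCompact s)
    (hu : ContDiff ℝ 1 u) (hus : ∀ x ∉ s, u x = 0) {g : E → ℝ} {P : C(E, ℝ)[X]}
    (hP : ∀ x t, P.eval₂ ((Pi.evalRingHom _ x).comp ContinuousMap.coeFnRingHom) t =
      g (x + t • u x)) :
    ∫ x in s, (ContinuousLinearMap.id ℝ E + fderiv ℝ u x).det * g (x + u x) ∂μ =
      ∫ x in s, g x ∂μ := by
  obtain ⟨D, hD⟩ := exists_polynomial_eval₂_eq_det (hu.continuous_fderiv one_ne_zero)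
  obtain ⟨Q, hQ⟩ := exists_polynomial_eval_eq_setIntegral μ hs (D * P)
  simp only [eval₂_mul, hD, hP] at hQ
  obtain ⟨δ, hδ, hconst⟩ := exists_forall_setIntegral_det_mul_comp_eq μ hs hu hus
  have hQC : Q = C (∫ x in s, g x ∂μ) := by
    refine eq_of_infinite_eval_eq _ _ ((Set.Ioo_infinite hδ).mono fun t ht => ?_)
    simp [hQ, hconst t ht]
  simpa [hQC] using (hQ 1).symm

end ChangeOfVariables

/-- A `C¹` map `x ↦ x + u x` that is the identity off a ball has dense image in that ball. If its
image stayed away from `y`, then integrating large powers of `M - ‖z - y‖ ^ 2`, which concentrate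
near `y`, would contradict the change of variables formula. -/
theorem exists_mem_closedBall_dist_add_lt {E : Type*} [NormedAddCommGroup E] [InnerProductSpace ℝ E]
    [FiniteDimensional ℝ E] {u : E → E} (hu : ContDiff ℝ 1 u)
    {R : ℝ} (hus : ∀ x ∉ closedBall 0 R, u x = 0) {y : E} (hy : y ∈ ball 0 R) {ε : ℝ} (hε : 0 < ε) :
    ∃ x ∈ closedBall 0 R, dist (x + u x) y < ε := by
  by_contra! hfar
  let _ : MeasurableSpace E := borel E
  have _ : BorelSpace E := ⟨rfl⟩
  have hs : IsCompact (closedBall (0 : E) R) := isCompact_closedBall 0 R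
  obtain ⟨M, hM⟩ := (hs.image_of_continuousOn (f := fun x => ‖x + u x - y‖ ^ 2)
    (by have := hu.continuous; fun_prop)).bddAbove
  replace hM : ∀ x ∈ closedBall (0 : E) R, ‖x + u x - y‖ ^ 2 ≤ M := fun x hx =>
    hM (Set.mem_image_of_mem _ hx)
  have hεM : ε ^ 2 ≤ M :=
    (pow_le_pow_left₀ hε.le (dist_eq_norm (y + u y) y ▸ hfar y (ball_subset_closedBall hy)) 2).trans
      (hM y (ball_subset_closedBall hy))
  have hM0 : 0 < M := (by positivity : 0 < ε ^ 2).trans_le hεM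
  let p : E → ℝ := fun z => M - ‖z - y‖ ^ 2
  have hp : Continuous p := by fun_prop
  let c₀ : C(E, ℝ) := ⟨fun x => M - ‖x - y‖ ^ 2, by fun_prop⟩
  let c₁ : C(E, ℝ) := ⟨fun x => 2 * inner ℝ (x - y) (u x), by have := hu.continuous; fun_prop⟩
  let c₂ : C(E, ℝ) := ⟨fun x => ‖u x‖ ^ 2, by have := hu.continuous; fun_prop⟩
  have hP (k : ℕ) (x : E) (t : ℝ) : (((C c₀ - C c₁ * X - C c₂ * X ^ 2) ^ k).eval₂
      ((Pi.evalRingHom _ x).comp ContinuousMap.coeFnRingHom) t) = p (x + t • u x) ^ k := by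
    have hx : x + t • u x - y = (x - y) + t • u x := by abel
    simp only [p, hx, norm_add_sq_real, inner_smul_right, norm_smul, mul_pow, Real.norm_eq_abs,
      sq_abs, eval₂_pow, eval₂_sub, eval₂_mul, eval₂_C, eval₂_X]
    simp [c₀, c₁, c₂]
    ring
  have key (k : ℕ) := setIntegral_det_mul_comp_eq volume hs hu hus (g := fun z => p z ^ k) (hP k)
  let J : E → ℝ := fun x => (ContinuousLinearMap.id ℝ E + fderiv ℝ u x).det
  have hJ : Continuous J := ContinuousLinearMap.continuous_det.comp
    (continuous_const.add (hu.continuous_fderiv one_ne_zero))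
  let S : Set E := ball y (ε / 2) ∩ ball 0 R
  have hSR : S ⊆ closedBall 0 R := Set.inter_subset_right.trans ball_subset_closedBall
  have hSo : IsOpen S := isOpen_ball.inter isOpen_ball
  have hSfin : volume S < ⊤ := (measure_mono hSR).trans_lt hs.measure_lt_top
  have hSpos : 0 < volume.real S :=
    ENNReal.toReal_pos (hSo.measure_pos volume ⟨y, mem_ball_self (by positivity), hy⟩).ne' hSfin.ne
  let a := (M - ε ^ 2) ^ 2
  let b := (M - (ε / 2) ^ 2) ^ 2
  have hab : a < b := pow_lt_pow_left₀ (by nlinarith) (by linarith) two_ne_zero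
  have hb : 0 < b := (sq_nonneg _).trans_lt hab
  have hlower (k : ℕ) : volume.real S * b ^ k ≤ ∫ x in closedBall 0 R, p x ^ (2 * k) := by
    have hint : IntegrableOn (fun x => p x ^ (2 * k)) (closedBall 0 R) :=
      (hp.pow _).continuousOn.integrableOn_compact hs
    calc volume.real S * b ^ k = ∫ x in S, b ^ k := by simp
      _ ≤ ∫ x in S, p x ^ (2 * k) := by
        refine setIntegral_mono_on (integrableOn_const hSfin.ne) (hint.mono_set hSR)
          hSo.measurableSet fun x hx => ?_
        have hxy : ‖x - y‖ < ε / 2 := mem_ball_iff_norm.mp hx.1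
        rw [pow_mul]
        refine pow_le_pow_left₀ hb.le (pow_le_pow_left₀ (by nlinarith) ?_ 2) k
        simp only [p]
        gcongr
      _ ≤ _ := setIntegral_mono_set hint
        (.of_forall fun x => (even_two_mul k).pow_nonneg _) hSR.eventuallyLE
  have hupper (k : ℕ) : ∫ x in closedBall 0 R, p x ^ (2 * k) ≤
      (∫ x in closedBall 0 R, |J x|) * a ^ k := by
    rw [← key, ← integral_mul_const]
    refine setIntegral_mono_on (ContinuousOn.integrableOn_compact hs ?_)
      (ContinuousOn.integrableOn_compact hs ?_) hs.measurableSet fun x hx => ?_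
    · exact (hJ.mul ((hp.comp (continuous_id.add hu.continuous)).pow _)).continuousOn
    · exact (hJ.abs.mul continuous_const).continuousOn
    · rw [pow_mul]
      refine mul_le_mul (le_abs_self _) (pow_le_pow_left₀ (sq_nonneg _)
        (pow_le_pow_left₀ (sub_nonneg.mpr (hM x hx)) ?_ 2) k) (by positivity) (abs_nonneg _)
      have := hfar x hx
      rw [dist_eq_norm] at this
      gcongr
  have hlim : Filter.Tendsto (fun k : ℕ => (∫ x in closedBall 0 R, |J x|) * (a / b) ^ k)
      Filter.atTop (nhds 0) := by
    simpa using (tendsto_pow_atTop_nhds_zero_of_lt_one (div_nonneg (sq_nonneg _) hb.le)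
      ((div_lt_one hb).mpr hab)).const_mul _
  refine hSpos.not_ge (ge_of_tendsto' hlim fun k => ?_)
  rw [div_pow, ← mul_div_assoc, le_div_iff₀ (by positivity)]
  exact (hlower k).trans (hupper k)

/-- A continuous self-map of a Euclidean space that is the identity off a ball is surjective. -/
theorem Continuous.surjective_of_eq_self_off_closedBall {E : Type*} [NormedAddCommGroup E]
    [InnerProductSpace ℝ E] [FiniteDimensional ℝ E] {g : E → E} (hg : Continuous g) {r : ℝ}
    (hgr : ∀ x ∉ closedBall 0 r, g x = x) : Surjective g := by
  intro y
  let R := max r (‖y‖ + 1)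
  have hgR : ∀ x ∉ closedBall 0 R, g x = x := fun x hx =>
    hgr x fun hx' => hx (closedBall_subset_closedBall (le_max_left _ _) hx')
  have hyR : y ∈ ball 0 R := mem_ball_zero_iff.mpr ((lt_add_one _).trans_le (le_max_right _ _))
  suffices y ∈ closure (g '' closedBall 0 R) by
    rw [((isCompact_closedBall 0 R).image hg).isClosed.closure_eq] at this
    exact Set.image_subset_range _ _ this
  rw [Metric.mem_closure_iff]
  intro ε hε
  obtain ⟨v, hv, hvg, hsupp⟩ := (hg.sub continuous_id).exists_contDiff_approx 1
    (ε := fun _ => ε / 2) continuous_const fun _ => half_pos hε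
  have hvR : ∀ x ∉ closedBall 0 R, v x = 0 := fun x hx => by
    by_contra hne
    exact hsupp hne (by simp [hgR x hx])
  obtain ⟨x, hx, hxy⟩ := exists_mem_closedBall_dist_add_lt hv hvR hyR (half_pos hε)
  refine ⟨g x, Set.mem_image_of_mem g hx, ?_⟩
  have hxg : dist (x + v x) (g x) < ε / 2 := by
    have := hvg x
    rw [dist_eq_norm] at this ⊢
    convert this using 2
    simp
    abel
  calc dist y (g x) ≤ dist (x + v x) y + dist (x + v x) (g x) := dist_triangle_left _ _ _
    _ < ε := by linarith

theorem bijective_of_injective_translation_at_infinity {n : ℕ}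
    (f : EuclideanSpace ℝ (Fin n) → EuclideanSpace ℝ (Fin n))
    (hinj : Function.Injective f) (hcont : Continuous f)
    (r : ℝ) (hr : 0 < r) (c : EuclideanSpace ℝ (Fin n))
    (htrans : ∀ x, r ≤ ‖x‖ → f x = c + x) :
    Function.Bijective f := by
  refine ⟨hinj, fun y => ?_⟩
  have hsurj : Surjective fun x => f x - c :=
    (hcont.sub continuous_const).surjective_of_eq_self_off_closedBall (r := r) fun x hx => by
      rw [mem_closedBall_zero_iff, not_le] at hx
      simp [htrans x hx.le]
  obtain ⟨x, hx⟩ := hsurj (y - c)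
  exact ⟨x, sub_left_injective hx⟩
end

section
/- Given P, Q, ζ > 0 with P < Q·e^{−1/ζ}, there is a nondecreasing C^∞ function φ : ℝ → [0,1] such that φ(x) = 0 for x ≤ P, φ(x) = 1 for x ≥ Q, and φ((1+σ)x) − φ(x) ≤ ζσ for all σ, x > 0. -/
open Real

theorem exists_contDiff_monotone_slope_le {a b ζ : ℝ} (hζ : 0 < ζ) (hab : 1 / ζ < b - a) :
    ∃ ψ : ℝ → ℝ, ContDiff ℝ (⊤ : ℕ∞) ψ ∧ Monotone ψ ∧
      (∀ t, t ≤ a → ψ t = 0) ∧ (∀ t, b ≤ t → ψ t = 1) ∧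
      (∀ s t, s ≤ t → ψ t - ψ s ≤ ζ * (t - s)) := by
  have hζ' : 0 < 1 / ζ := by positivity
  let h : ContDiffBump ((a + b) / 2) :=
    ⟨1 / ζ / 2, (b - a) / 2, by positivity, by linarith⟩
  have hcont : Continuous h := h.continuous
  have hint (s t : ℝ) : IntervalIntegrable h MeasureTheory.volume s t :=
    hcont.intervalIntegrable s t
  have hsupp : Function.support h = Set.Ioo a b := by
    rw [h.support_eq, Real.ball_eq_Ioo]
    congr 1 <;> simp only [h] <;> ring
  have hzero {x : ℝ} (hx : x ∉ Set.Ioo a b) : h x = 0 := by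
    rwa [← hsupp, Function.notMem_support] at hx
  have hI : 1 / ζ ≤ ∫ x in a..b, h x := by
    rw [intervalIntegral.integral_eq_integral_of_support_subset
      (hsupp.trans_subset Set.Ioo_subset_Ioc_self)]
    refine le_trans (le_of_eq ?_) (h.measure_closedBall_le_integral MeasureTheory.volume)
    simp only [h, MeasureTheory.measureReal_def, Real.volume_closedBall]
    rw [ENNReal.toReal_ofReal (by positivity)]
    ring
  set I := ∫ x in a..b, h x
  have hIpos : 0 < I := hζ'.trans_le hI
  have hsub (s t : ℝ) : (∫ x in a..t, h x) / I - (∫ x in a..s, h x) / I =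
      (∫ x in s..t, h x) / I := by
    rw [← sub_div, intervalIntegral.integral_interval_sub_left (hint _ _) (hint _ _)]
  refine ⟨fun t => (∫ x in a..t, h x) / I, ?_, ?_, ?_, ?_, ?_⟩
  · have hd (t : ℝ) : HasDerivAt (fun t => ∫ x in a..t, h x) (h t) t :=
      hcont.integral_hasStrictDerivAt a t |>.hasDerivAt
    refine ContDiff.div_const (contDiff_infty_iff_deriv.2 ⟨fun t => (hd t).differentiableAt, ?_⟩) I
    rw [funext fun t => (hd t).deriv]
    exact h.contDiff
  · intro s t hst
    rw [← sub_nonneg, hsub]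
    exact div_nonneg (intervalIntegral.integral_nonneg hst fun x _ => h.nonneg) hIpos.le
  · intro t ht
    have : ∫ x in t..a, h x = 0 := by
      rw [intervalIntegral.integral_congr (g := fun _ => (0 : ℝ))]
      · simp
      · intro x hx
        rw [Set.uIcc_of_le ht] at hx
        exact hzero fun hx' => (hx.2.trans_lt hx'.1).false
    simp only
    rw [intervalIntegral.integral_symm, this, neg_zero, zero_div]
  · intro t ht
    have : ∫ x in b..t, h x = 0 := by
      rw [intervalIntegral.integral_congr (g := fun _ => (0 : ℝ))]
      · simp
      · intro x hx
        rw [Set.uIcc_of_le ht] at hx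
        exact hzero fun hx' => (hx'.2.trans_le hx.1).false
    simp only
    rw [← intervalIntegral.integral_add_adjacent_intervals (hint a b) (hint b t), this, add_zero,
      div_self hIpos.ne']
  · intro s t hst
    simp only
    rw [hsub, div_le_iff₀ hIpos]
    have h1 : ∫ x in s..t, h x ≤ t - s := by
      simpa using intervalIntegral.integral_mono_on hst (hint s t)
        (intervalIntegrable_const (c := (1 : ℝ))) fun x _ => h.le_one
    have h2 : 1 ≤ ζ * I := by rwa [div_le_iff₀' hζ] at hI
    nlinarith [sub_nonneg.2 hst]

theorem exists_smooth_log_like (P Q ζ : ℝ) (hP : 0 < P) (hQ : 0 < Q)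
    (hζ : 0 < ζ) (hPQ : P < Q * Real.exp (-1 / ζ)) :
    ∃ φ : ℝ → ℝ, ContDiff ℝ (⊤ : ℕ∞) φ ∧ Monotone φ ∧
      (∀ x, φ x ∈ Set.Icc (0 : ℝ) 1) ∧
      (∀ x, x ≤ P → φ x = 0) ∧ (∀ x, Q ≤ x → φ x = 1) ∧
      (∀ σ x : ℝ, 0 < σ → 0 < x → φ ((1 + σ) * x) - φ x ≤ ζ * σ) := by
  have hab : 1 / ζ < Real.log Q - Real.log P := by
    have := Real.log_lt_log hP hPQ
    rw [Real.log_mul hQ.ne' (Real.exp_pos _).ne', Real.log_exp, neg_div] at this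
    linarith
  obtain ⟨ψ, hsmooth, hmono, hψ0, hψ1, hslope⟩ := exists_contDiff_monotone_slope_le hζ hab
  have hnonneg (t : ℝ) : 0 ≤ ψ t :=
    (hψ0 _ (min_le_right t (Real.log P))).symm.trans_le (hmono (min_le_left _ _))
  have hle_one (t : ℝ) : ψ t ≤ 1 :=
    (hmono (le_max_left _ _)).trans_eq (hψ1 _ (le_max_right t (Real.log Q)))
  let φ : ℝ → ℝ := fun x => if 0 < x then ψ (Real.log x) else 0
  have hφ {x : ℝ} (hx : 0 < x) : φ x = ψ (Real.log x) := if_pos hx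
  have hφ0 {x : ℝ} (hx : x ≤ P) : φ x = 0 := by
    by_cases h : 0 < x
    · rw [hφ h, hψ0 _ (Real.log_le_log h hx)]
    · exact if_neg h
  have hmem (x : ℝ) : φ x ∈ Set.Icc (0 : ℝ) 1 := by
    by_cases h : 0 < x
    · rw [hφ h]
      exact ⟨hnonneg _, hle_one _⟩
    · simp [φ, h]
  refine ⟨φ, ?_, ?_, hmem, fun x => hφ0, ?_, ?_⟩
  · rw [contDiff_iff_contDiffAt]
    intro x
    rcases lt_or_ge x P with hx | hx
    · refine (contDiffAt_const (c := (0 : ℝ))).congr_of_eventuallyEq ?_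
      filter_upwards [Iio_mem_nhds hx] with y hy using hφ0 (le_of_lt hy)
    · have hx0 : 0 < x := hP.trans_le hx
      refine (hsmooth.contDiffAt.comp x (Real.contDiffAt_log.2 hx0.ne')).congr_of_eventuallyEq ?_
      filter_upwards [Ioi_mem_nhds hx0] with y hy using hφ hy
  · intro x y hxy
    by_cases h : 0 < x
    · rw [hφ h, hφ (h.trans_le hxy)]
      exact hmono (Real.log_le_log h hxy)
    · rw [hφ0 ((not_lt.1 h).trans hP.le)]
      exact (hmem y).1
  · intro x hx
    rw [hφ (hQ.trans_le hx), hψ1 _ (Real.log_le_log hQ hx)]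
  · intro σ x hσ hx
    have hσ' : 0 < 1 + σ := by linarith
    rw [hφ hx, hφ (mul_pos hσ' hx), Real.log_mul hσ'.ne' hx.ne']
    have hlog : Real.log (1 + σ) ≤ σ := by linarith [Real.log_le_sub_one_of_pos hσ']
    calc
      _ ≤ ζ * (Real.log (1 + σ) + Real.log x - Real.log x) :=
        hslope _ _ (by linarith [Real.log_nonneg (by linarith : 1 ≤ 1 + σ)])
      _ ≤ ζ * σ := by
        rw [add_sub_cancel_right]
        gcongr
end

section
/- Assume f(x) = ν(‖x‖)x where ν : [0,∞) → [0,∞) and the map r ↦ ν(r)·r is strictly increasing. Then tw(f) ≤ π/2; that is, ∠(x₁ − x₀, f(x₁) − f(x₀)) ≤ π/2 for all x₀ ≠ x₁ with f(x₀) ≠ f(x₁). -/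
open Real InnerProductGeometry

/-- A radial map `x ↦ ν ‖x‖ • x` with `ν ≥ 0` and `r ↦ ν r * r` monotone is a monotone operator. -/
theorem inner_sub_radial_sub_nonneg {E : Type*} [NormedAddCommGroup E] [InnerProductSpace ℝ E]
    {ν : ℝ → ℝ} (hν : ∀ r, 0 ≤ r → 0 ≤ ν r)
    (hmono : MonotoneOn (fun r => ν r * r) (Set.Ici (0 : ℝ))) (x y : E) :
    0 ≤ inner ℝ (x - y) (ν ‖x‖ • x - ν ‖y‖ • y) := by
  have hexpand : inner ℝ (x - y) (ν ‖x‖ • x - ν ‖y‖ • y) =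
      ν ‖x‖ * ‖x‖ ^ 2 + ν ‖y‖ * ‖y‖ ^ 2 - (ν ‖x‖ + ν ‖y‖) * inner ℝ x y := by
    simp only [inner_sub_left, inner_sub_right, real_inner_smul_right,
      real_inner_self_eq_norm_sq, real_inner_comm x y]
    ring
  have hcs : (ν ‖x‖ + ν ‖y‖) * inner ℝ x y ≤ (ν ‖x‖ + ν ‖y‖) * (‖x‖ * ‖y‖) :=
    mul_le_mul_of_nonneg_left (real_inner_le_norm x y)
      (add_nonneg (hν _ (norm_nonneg x)) (hν _ (norm_nonneg y)))
  have hprod : 0 ≤ (‖x‖ - ‖y‖) * (ν ‖x‖ * ‖x‖ - ν ‖y‖ * ‖y‖) := by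
    rcases le_total ‖x‖ ‖y‖ with h | h
    · exact mul_nonneg_of_nonpos_of_nonpos (sub_nonpos.2 h)
        (sub_nonpos.2 (hmono (norm_nonneg x) (norm_nonneg y) h))
    · exact mul_nonneg (sub_nonneg.2 h)
        (sub_nonneg.2 (hmono (norm_nonneg y) (norm_nonneg x) h))
  rw [hexpand]
  linarith

/-- A pure radial expansion has twist at most `π/2`. -/
theorem twist_of_expansion_le {n : ℕ}
    (ν : ℝ → ℝ) (hν : ∀ r, 0 ≤ r → 0 ≤ ν r)
    (hmono : StrictMonoOn (fun r => ν r * r) (Set.Ici (0 : ℝ)))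
    (f : EuclideanSpace ℝ (Fin n) → EuclideanSpace ℝ (Fin n))
    (hf : ∀ x, f x = ν ‖x‖ • x) :
    ∀ x₀ x₁ : EuclideanSpace ℝ (Fin n), x₀ ≠ x₁ → f x₀ ≠ f x₁ →
      angle (x₁ - x₀) (f x₁ - f x₀) ≤ π / 2 := by
  intro x₀ x₁ _ _
  rw [hf, hf, angle, Real.arccos_le_pi_div_two]
  exact div_nonneg (inner_sub_radial_sub_nonneg hν hmono.monotoneOn x₁ x₀) (by positivity)
end
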